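/- Lemma (Appendix F, reduction lemma): Let n, n', d be positive integers with d ≤ n', let G ∈ ℝ^{n'×n} and γ ∈ ℝ, and suppose C_d^{n→n'} ⊆ {P ∈ P^{n→n'} : ⟨G,P⟩ ≤ γ}. Then there exist Ĝ ∈ ℝ^{n'×n} having at most n'−d nonzero entries in each column and γ̂ ∈ ℝ such that C_d^{n→n'} ⊆ {P ∈ P^{n→n'} : ⟨Ĝ,P⟩ ≤ γ̂} ⊆ {P ∈ P^{n→n'} : ⟨G,P⟩ ≤ γ}. -/

import Mathlib

open Finset

/-- A classical channel: an `n' × n` column-stochastic real matrix. -/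
def IsChannel {n n' : ℕ} (P : Matrix (Fin n') (Fin n) ℝ) : Prop :=
  (∀ y x, 0 ≤ P y x) ∧ ∀ x, ∑ y, P y x = 1

/-- A vertex of the signaling polytope: a column-stochastic 0/1 matrix with
at most `d` nonzero rows. -/
def IsVertex {n n' : ℕ} (d : ℕ) (V : Matrix (Fin n') (Fin n) ℝ) : Prop :=
  IsChannel V ∧ (∀ y x, V y x = 0 ∨ V y x = 1) ∧
    ({y : Fin n' | ∃ x, V y x ≠ 0}).ncard ≤ d

/-- The signaling polytope `C_d^{n → n'}`. -/
def signalingPolytope (n n' d : ℕ) : Set (Matrix (Fin n') (Fin n) ℝ) :=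
  convexHull ℝ {V | IsVertex d V}

/-- The Euclidean inner product `⟨G, P⟩ = ∑_{x,y} G_{y,x} P(y|x)`. -/
def bip {n n' : ℕ} (G P : Matrix (Fin n') (Fin n) ℝ) : ℝ :=
  ∑ x, ∑ y, G y x * P y x

/-- A `d`-th smallest value of `f`: at least `d` points lie weakly below it, and every `d`-element
set contains a point weakly above it. -/
theorem exists_dth_smallest {α : Type*} [Fintype α] (f : α → ℝ) {d : ℕ} (hd : 0 < d)
    (hdα : d ≤ Fintype.card α) :
    ∃ t : ℝ, d ≤ #{y | f y ≤ t} ∧ ∀ S : Finset α, #S = d → ∃ y ∈ S, t ≤ f y := by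
  have hmax : ∀ S : Finset α, #S = d → ∃ y ∈ S, ∀ z ∈ S, f z ≤ f y := fun S hS =>
    S.exists_max_image f (card_pos.mp (hS ▸ hd))
  let T : Finset α := {y | d ≤ #{z | f z ≤ f y}}
  have hT : ∀ S : Finset α, #S = d → ∃ y ∈ S, y ∈ T := by
    intro S hS
    obtain ⟨y, hy, hyS⟩ := hmax S hS
    refine ⟨y, hy, mem_filter.mpr ⟨mem_univ _, hS ▸ card_le_card fun z hz => ?_⟩⟩
    exact mem_filter.mpr ⟨mem_univ _, hyS z hz⟩
  obtain ⟨S₀, -, hS₀⟩ := exists_subset_card_eq (s := (univ : Finset α)) hdα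
  obtain ⟨y₀, -, hy₀⟩ := hT S₀ hS₀
  obtain ⟨y, hy, hmin⟩ := T.exists_min_image f ⟨y₀, hy₀⟩
  refine ⟨f y, (mem_filter.mp hy).2, fun S hS => ?_⟩
  obtain ⟨z, hz, hzT⟩ := hT S hS
  exact ⟨z, hz, hmin z hzT⟩

theorem bip_le_sum {n n' : ℕ} {G P : Matrix (Fin n') (Fin n) ℝ} (hP : IsChannel P)
    {m : Fin n → ℝ} (hm : ∀ y x, P y x ≠ 0 → G y x ≤ m x) : bip G P ≤ ∑ x, m x := by
  refine sum_le_sum fun x _ => ?_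
  calc ∑ y, G y x * P y x ≤ ∑ y, m x * P y x := sum_le_sum fun y _ => by
        by_cases h : P y x = 0
        · simp [h]
        · exact mul_le_mul_of_nonneg_right (hm y x h) (hP.1 y x)
    _ = m x := by rw [← mul_sum, hP.2 x, mul_one]

theorem bip_le_bip_add_sum {n n' : ℕ} {G H P : Matrix (Fin n') (Fin n) ℝ} (hP : IsChannel P)
    {t : Fin n → ℝ} (ht : ∀ y x, G y x ≤ H y x + t x) : bip G P ≤ bip H P + ∑ x, t x := by
  unfold bip
  rw [← sum_add_distrib]
  refine sum_le_sum fun x _ => ?_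
  calc ∑ y, G y x * P y x ≤ ∑ y, (H y x + t x) * P y x := sum_le_sum fun y _ =>
        mul_le_mul_of_nonneg_right (ht y x) (hP.1 y x)
    _ = ∑ y, H y x * P y x + t x := by
        simp_rw [add_mul]
        rw [sum_add_distrib, ← mul_sum, hP.2 x, mul_one]

/-- The deterministic channel sending `x` to `g x`. -/
def deterministicChannel {n n' : ℕ} (g : Fin n → Fin n') : Matrix (Fin n') (Fin n) ℝ :=
  fun y x => if y = g x then 1 else 0

theorem isVertex_deterministicChannel {n n' : ℕ} {S : Finset (Fin n')} {g : Fin n → Fin n'}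
    (hg : ∀ x, g x ∈ S) : IsVertex #S (deterministicChannel g) := by
  refine ⟨⟨fun y x => ?_, fun x => ?_⟩, fun y x => ?_, ?_⟩
  · unfold deterministicChannel; split_ifs <;> norm_num
  · simp [deterministicChannel]
  · unfold deterministicChannel; split_ifs <;> simp
  · rw [← Set.ncard_coe_finset S]
    refine Set.ncard_le_ncard ?_ S.finite_toSet
    rintro y ⟨x, hx⟩
    by_cases hy : y = g x
    · exact hy ▸ mem_coe.mpr (hg x)
    · exact absurd (if_neg hy) hx

theorem bip_deterministicChannel {n n' : ℕ} (G : Matrix (Fin n') (Fin n) ℝ) (g : Fin n → Fin n') :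
    bip G (deterministicChannel g) = ∑ x, G (g x) x := by
  simp [bip, deterministicChannel]

theorem convex_bip_le {n n' : ℕ} (G : Matrix (Fin n') (Fin n) ℝ) (γ : ℝ) :
    Convex ℝ {P | bip G P ≤ γ} := by
  refine convex_halfSpace_le ⟨fun P Q => ?_, fun c P => ?_⟩ γ
  · simp [bip, mul_add, sum_add_distrib]
  · simp [bip, mul_sum, mul_left_comm]

/-- Reduction lemma (Appendix F): any valid Bell inequality `(G, γ)` of
`C_d^{n → n'}` can be replaced by one `(G', γ')` with at most `n' - d` nonzero
entries per column that bounds `C_d^{n → n'}` at least as tightly. -/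
theorem reduction_lemma (n n' d : ℕ) (hn : 0 < n) (hn' : 0 < n') (hd : 0 < d)
    (hdn' : d ≤ n') (G : Matrix (Fin n') (Fin n) ℝ) (γ : ℝ)
    (h : signalingPolytope n n' d ⊆ {P | IsChannel P ∧ bip G P ≤ γ}) :
    ∃ (G' : Matrix (Fin n') (Fin n) ℝ) (γ' : ℝ),
      (∀ x, ({y : Fin n' | G' y x ≠ 0}).ncard ≤ n' - d) ∧
      signalingPolytope n n' d ⊆ {P | IsChannel P ∧ bip G' P ≤ γ'} ∧
      {P : Matrix (Fin n') (Fin n) ℝ | IsChannel P ∧ bip G' P ≤ γ'} ⊆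
        {P | IsChannel P ∧ bip G P ≤ γ} := by
  choose t ht_card ht using fun x =>
    exists_dth_smallest (fun y => G y x) hd (hdn'.trans_eq (Fintype.card_fin n').symm)
  refine ⟨fun y x => max (G y x) (t x) - t x, γ - ∑ x, t x, fun x => ?_, fun P hP => ?_,
    fun P hP => ⟨hP.1, ?_⟩⟩
  · have hset : {y : Fin n' | max (G y x) (t x) - t x ≠ 0} =
        ((({y | G y x ≤ t x} : Finset (Fin n'))ᶜ : Finset (Fin n')) : Set (Fin n')) := by
      ext y
      simp [sub_eq_zero]
    rw [hset, Set.ncard_coe_finset, card_compl, Fintype.card_fin]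
    exact Nat.sub_le_sub_left (ht_card x) n'
  · refine ⟨(h hP).1, convexHull_min (fun V hV => ?_) (convex_bip_le _ _) hP⟩
    classical
    obtain ⟨S, hVS, hS⟩ : ∃ S : Finset (Fin n'), {y | ∃ x, V y x ≠ 0} ⊆ (S : Set (Fin n')) ∧
        #S = d := by
      have hcard := hV.2.2
      rw [Set.ncard_eq_toFinset_card'] at hcard
      obtain ⟨S, hsub, hS⟩ := exists_superset_card_eq hcard
        (hdn'.trans_eq (Fintype.card_fin n').symm)
      exact ⟨S, fun y hy => hsub (Set.mem_toFinset.mpr hy), hS⟩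
    choose g hgS hg using fun x =>
      S.exists_max_image (fun y => G y x) (card_pos.mp (hS ▸ hd))
    have hle := (h (subset_convexHull ℝ _ (hS ▸ isVertex_deterministicChannel hgS))).2
    rw [bip_deterministicChannel] at hle
    have hV_le : bip (fun y x => max (G y x) (t x) - t x) V ≤ ∑ x, (G (g x) x - t x) := by
      refine bip_le_sum hV.1 fun y x hyx => sub_le_sub_right (max_le ?_ ?_) _
      · exact hg x y (hVS ⟨x, hyx⟩)
      · obtain ⟨z, hz, htz⟩ := ht x S hS
        exact htz.trans (hg x z hz)
    rw [sum_sub_distrib] at hV_le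
    exact hV_le.trans (sub_le_sub_right hle _)
  · have hG : bip G P ≤ bip (fun y x => max (G y x) (t x) - t x) P + ∑ x, t x :=
      bip_le_bip_add_sum hP.1 fun y x => by simp
    linarith [hP.2]
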